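/- arXiv:1703.03842 — 3 statements merged into one kernel-verified Lean document; each statement's English description precedes it below -/
import Mathlib

section
/- With probability 1 there exist a time M and a category j such that x_n = j for all n ≥ M; equivalently P(⋃_{n=1}^∞ A_n) = 1. In particular, in the finite-capacity model all categories but one become extinct with probability 1. -/
open MeasureTheory Filter Topology

/-- The simple exemplar weight model with finite capacity from the paper
"Effects of Limiting Memory Capacity on the Behaviour of Exemplar Dynamics".

There are `k ≥ 2` categories, each storing at most `N ≥ 1` exemplars, and the
weights decay by `β = exp (-lam)` at each step, `lam > 0`.  `w n j m ω` is the
weight of the `(m+1)`-st exemplar (positions are 0-based) of category `j` at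
time `n`; weights lie in `[0,1]`, are nonincreasing in the position, and vanish
at positions `≥ N`.  The initial weights are deterministic with at least one
nonzero weight.  At each time a random category `x n` is chosen with conditional
probability `W_j^n / W_tot^n` given the natural filtration `F`, where
`W_j^n = ∑_{m<N} w n j m` and `W_tot^n = ∑_j W_j^n`; then the chosen category
gets a fresh exemplar of weight `1` on top, its old exemplars shift down and
decay by `β` (the lowest-weight one being discarded), and all other categories'
exemplars decay by `β`. -/
structure FiniteExemplarModel (Ω : Type*) [mΩ : MeasurableSpace Ω] (μ : Measure Ω)
    (k N : ℕ) (lam : ℝ) where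
  hk : 2 ≤ k
  hN : 1 ≤ N
  hlam : 0 < lam
  hprob : IsProbabilityMeasure μ
  /-- the exemplar weights: time, category, (0-based) position, outcome -/
  w : ℕ → Fin k → ℕ → Ω → ℝ
  /-- the category the sound at time `n` is classified as -/
  x : ℕ → Ω → Fin k
  /-- the natural filtration `F_n = σ(w^q, 0 < q ≤ n)` -/
  F : Filtration ℕ mΩ
  range01 : ∀ n j m ω, 0 ≤ w n j m ω ∧ w n j m ω ≤ 1
  mono : ∀ n j m ω, w n j (m + 1) ω ≤ w n j m ω
  cap : ∀ n j m ω, N ≤ m → w n j m ω = 0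
  init_det : ∀ j m ω ω', w 0 j m ω = w 0 j m ω'
  init_nonzero : ∃ j m ω, w 0 j m ω ≠ 0
  w_meas : ∀ n j m, StronglyMeasurable[F n] (w n j m)
  x_meas : ∀ n, Measurable[F (n + 1)] (x n)
  dyn_self_first : ∀ n ω, w (n + 1) (x n ω) 0 ω = 1
  dyn_self : ∀ n ω m, m + 1 < N →
    w (n + 1) (x n ω) (m + 1) ω = Real.exp (-lam) * w n (x n ω) m ω
  dyn_other : ∀ n ω i m, i ≠ x n ω →
    w (n + 1) i m ω = Real.exp (-lam) * w n i m ω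
  classify : ∀ n (j : Fin k),
    μ[Set.indicator {ω | x n ω = j} (fun _ => (1 : ℝ)) | F n]
      =ᵐ[μ] fun ω => (∑ m ∈ Finset.range N, w n j m ω) /
        (∑ i : Fin k, ∑ m ∈ Finset.range N, w n i m ω)

lemma exp_neg_le_div_add {a b c : ℝ} (ha : 1 ≤ a) (hb : 0 ≤ b) (hbc : b ≤ c) :
    Real.exp (-c) ≤ a / (a + b) := by
  have h1 : (1 + c) * Real.exp (-c) ≤ 1 := by
    have := mul_le_mul_of_nonneg_right (Real.add_one_le_exp c) (Real.exp_pos (-c)).le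
    rw [← Real.exp_add, add_neg_cancel, Real.exp_zero] at this
    linarith
  rw [le_div_iff₀ (by linarith)]
  have h2 := Real.exp_pos (-c)
  calc Real.exp (-c) * (a + b) ≤ Real.exp (-c) * (a * (1 + c)) := by
        refine mul_le_mul_of_nonneg_left ?_ h2.le
        nlinarith
    _ = a * ((1 + c) * Real.exp (-c)) := by ring
    _ ≤ a * 1 := mul_le_mul_of_nonneg_left h1 (by linarith)
    _ = a := mul_one a

section CondExp

variable {Ω : Type*} {m mΩ : MeasurableSpace Ω} {μ : Measure Ω} [IsFiniteMeasure μ]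

/-- A lower bound on a conditional probability from its integrated form. -/
lemma le_condExp_indicator_of_forall_subset (hm : m ≤ mΩ) {A B : Set Ω}
    (hA : MeasurableSet A) (hB : MeasurableSet[m] B) {ε : ℝ}
    (h : ∀ G, MeasurableSet[m] G → G ⊆ B → ε * μ.real G ≤ μ.real (G ∩ A)) :
    ∀ᵐ ω ∂μ, ω ∈ B → ε ≤ (μ[A.indicator (fun _ => (1 : ℝ)) | m]) ω := by
  set g := μ[A.indicator (fun _ => (1 : ℝ)) | m] with hg
  have hAint : Integrable (A.indicator (fun _ => (1 : ℝ))) μ :=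
    (integrable_const 1).indicator hA
  have hgm : StronglyMeasurable[m] (B.indicator g) :=
    stronglyMeasurable_condExp.indicator hB
  have hfm : StronglyMeasurable[m] (B.indicator fun _ => ε) :=
    stronglyMeasurable_const.indicator hB
  have key : (B.indicator fun _ => ε) ≤ᵐ[μ.trim hm] B.indicator g := by
    refine ae_le_of_forall_setIntegral_le ?_ ?_ fun s hs _ => ?_
    · exact ((integrable_const ε).indicator (hm _ hB)).trim hm hfm
    · exact (integrable_condExp.indicator (hm _ hB)).trim hm hgm
    · rw [← setIntegral_trim hm hfm hs, ← setIntegral_trim hm hgm hs,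
        setIntegral_indicator (hm _ hB), setIntegral_indicator (hm _ hB),
        setIntegral_condExp hm hAint (hs.inter hB), setIntegral_indicator hA,
        setIntegral_const, setIntegral_const]
      simpa [mul_comm] using h (s ∩ B) (hs.inter hB) Set.inter_subset_right
  filter_upwards [ae_le_of_ae_le_trim key] with ω hω hωB
  simpa [hωB] using hω

/-- An integrated lower bound from a pointwise bound on a conditional probability. -/
lemma mul_measureReal_le_of_le_condExp (hm : m ≤ mΩ) {A G : Set Ω}
    (hA : MeasurableSet A) (hG : MeasurableSet[m] G) {c : ℝ}
    (h : ∀ᵐ ω ∂μ, ω ∈ G → c ≤ (μ[A.indicator (fun _ => (1 : ℝ)) | m]) ω) :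
    c * μ.real G ≤ μ.real (G ∩ A) := by
  have hAint : Integrable (A.indicator (fun _ => (1 : ℝ))) μ :=
    (integrable_const 1).indicator hA
  have h1 : ∫ _ in G, c ∂μ ≤ ∫ ω in G, (μ[A.indicator (fun _ => (1 : ℝ)) | m]) ω ∂μ :=
    setIntegral_mono_on_ae (integrable_const c).integrableOn
      integrable_condExp.integrableOn (hm _ hG) h
  rw [setIntegral_condExp hm hAint hG, setIntegral_indicator hA, setIntegral_const,
    setIntegral_const] at h1
  simpa [mul_comm] using h1

/-- A consequence of Lévy's zero-one law: an event whose conditional probabilities along a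
filtration are bounded below by a positive constant is almost sure. -/
lemma ae_mem_of_forall_le_condExp {F : Filtration ℕ mΩ} {A : Set Ω}
    (hA : MeasurableSet[⨆ n, F n] A) {ε : ℝ} (hε : 0 < ε)
    (h : ∀ n, ∀ᵐ ω ∂μ, ε ≤ (μ[A.indicator (fun _ => (1 : ℝ)) | F (n + 1)]) ω) :
    ∀ᵐ ω ∂μ, ω ∈ A := by
  have hle : (⨆ n, F n) ≤ mΩ := iSup_le fun n => F.le n
  have hAint : Integrable (A.indicator (fun _ => (1 : ℝ))) μ :=
    (integrable_const 1).indicator (hle _ hA)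
  filter_upwards [tendsto_ae_condExp (ℱ := F) (μ := μ) (A.indicator fun _ => (1 : ℝ)),
    ae_all_iff.2 h] with ω hlim hω
  rw [condExp_of_stronglyMeasurable hle (stronglyMeasurable_const.indicator hA) hAint] at hlim
  have hlow : ε ≤ A.indicator (fun _ => (1 : ℝ)) ω :=
    ge_of_tendsto' (hlim.comp (tendsto_add_atTop_nat 1)) hω
  by_contra hωA
  rw [Set.indicator_of_notMem hωA] at hlow
  exact hε.not_ge hlow

end CondExp

namespace FiniteExemplarModel

variable {Ω : Type*} [mΩ : MeasurableSpace Ω] {μ : Measure Ω} {k N : ℕ} {lam : ℝ}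
  (M : FiniteExemplarModel Ω μ k N lam)

/-- The total weight `W_j^n` of category `j` at time `n`. -/
def weight (n : ℕ) (j : Fin k) (ω : Ω) : ℝ := ∑ m ∈ Finset.range N, M.w n j m ω

/-- The event that category `j` is chosen at each of the times `n, …, n + r`. -/
def run (j : Fin k) (n r : ℕ) : Set Ω := {ω | ∀ s ≤ r, M.x (n + s) ω = j}

/-- The event that category `j` is chosen at all times from `n` on. -/
def forever (j : Fin k) (n : ℕ) : Set Ω := {ω | ∀ s, M.x (n + s) ω = j}

/-- The event that one category is chosen at all late times. -/
def fixation : Set Ω := ⋃ j, ⋃ n, M.forever j n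

lemma weight_nonneg (n : ℕ) (j : Fin k) (ω : Ω) : 0 ≤ M.weight n j ω :=
  Finset.sum_nonneg fun m _ => (M.range01 n j m ω).1

lemma weight_le (n : ℕ) (j : Fin k) (ω : Ω) : M.weight n j ω ≤ N := by
  simpa [weight] using Finset.sum_le_sum fun m (_ : m ∈ Finset.range N) => (M.range01 n j m ω).2

lemma weight_add_of_ne {n r : ℕ} {i j : Fin k} {ω : Ω} (hij : i ≠ j)
    (h : ∀ s < r, M.x (n + s) ω = j) :
    M.weight (n + r) i ω = Real.exp (-lam) ^ r * M.weight n i ω := by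
  induction r with
  | zero => simp
  | succ r ih =>
    have hx : i ≠ M.x (n + r) ω := by rwa [h r r.lt_succ_self]
    rw [pow_succ', mul_assoc, ← ih fun s hs => h s (hs.trans r.lt_succ_self), weight, weight,
      Finset.mul_sum]
    exact Finset.sum_congr rfl fun m _ => M.dyn_other (n + r) ω i m hx

lemma one_le_weight_succ (n : ℕ) (ω : Ω) : 1 ≤ M.weight (n + 1) (M.x n ω) ω := by
  rw [← M.dyn_self_first n ω]
  exact Finset.single_le_sum (f := fun m => M.w (n + 1) (M.x n ω) m ω)
    (fun m _ => (M.range01 _ _ m ω).1) (Finset.mem_range.2 M.hN)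

lemma exp_neg_le_of_mem_run {j : Fin k} {n r : ℕ} {ω : Ω} (h : ω ∈ M.run j n r) :
    Real.exp (-(k * N * Real.exp (-lam) ^ (r + 1))) ≤
      M.weight (n + r + 1) j ω / ∑ i, M.weight (n + r + 1) i ω := by
  rw [← Finset.add_sum_erase _ _ (Finset.mem_univ j)]
  refine exp_neg_le_div_add ?_ (Finset.sum_nonneg fun i _ => M.weight_nonneg _ i ω) ?_
  · simpa [h r le_rfl] using M.one_le_weight_succ (n + r) ω
  · have hi : ∀ i ∈ Finset.univ.erase j,
        M.weight (n + r + 1) i ω ≤ N * Real.exp (-lam) ^ (r + 1) := fun i hi => by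
      rw [add_assoc, M.weight_add_of_ne (Finset.ne_of_mem_erase hi)
        fun s hs => h s (Nat.lt_succ_iff.1 hs), mul_comm]
      gcongr
      exact M.weight_le n i ω
    refine (Finset.sum_le_card_nsmul _ _ _ hi).trans ?_
    rw [nsmul_eq_mul, mul_assoc]
    gcongr
    simp

lemma measurableSet_eq (n : ℕ) (j : Fin k) : MeasurableSet[M.F (n + 1)] {ω | M.x n ω = j} :=
  M.x_meas n (measurableSet_singleton j)

lemma measurableSet_run (j : Fin k) (n r : ℕ) :
    MeasurableSet[M.F (n + r + 1)] (M.run j n r) := by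
  have : M.run j n r = ⋂ s, ⋂ (_ : s ≤ r), {ω | M.x (n + s) ω = j} := by
    ext ω; simp [run]
  rw [this]
  exact MeasurableSet.iInter fun s => MeasurableSet.iInter fun hs =>
    M.F.mono (by lia) _ (M.measurableSet_eq (n + s) j)

lemma iInter_run (j : Fin k) (n : ℕ) : ⋂ r, M.run j n r = M.forever j n := by
  ext ω
  simp only [run, forever, Set.mem_iInter, Set.mem_ofPred_eq]
  exact ⟨fun h s => h s s le_rfl, fun h _ s _ => h s⟩

lemma antitone_run (j : Fin k) (n : ℕ) : Antitone (M.run j n) :=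
  fun _ _ hrs _ h s hs => h s (hs.trans hrs)

lemma measurableSet_fixation : MeasurableSet[⨆ n, M.F n] M.fixation := by
  refine MeasurableSet.iUnion fun j => MeasurableSet.iUnion fun n => ?_
  rw [← M.iInter_run]
  exact MeasurableSet.iInter fun r => le_iSup M.F _ _ (M.measurableSet_run j n r)

lemma run_succ (j : Fin k) (n r : ℕ) :
    M.run j n (r + 1) = M.run j n r ∩ {ω | M.x (n + r + 1) ω = j} := by
  ext ω
  simp only [run, Set.mem_inter_iff, Set.mem_ofPred_eq, Nat.le_succ_iff, or_imp, forall_and,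
    forall_eq, Nat.succ_eq_add_one, add_assoc]

lemma exp_neg_mul_measureReal_le_run {j : Fin k} {n : ℕ} {G : Set Ω}
    (hG : MeasurableSet[M.F (n + 1)] G) (hGj : G ⊆ {ω | M.x n ω = j}) (r : ℕ) :
    Real.exp (-∑ s ∈ Finset.range r, k * N * Real.exp (-lam) ^ (s + 1)) * μ.real G ≤
      μ.real (G ∩ M.run j n r) := by
  have := M.hprob
  induction r with
  | zero =>
    have : G ∩ M.run j n 0 = G := Set.inter_eq_left.2 fun ω hω s hs => by
      rw [Nat.le_zero.1 hs]; exact hGj hω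
    simp [this]
  | succ r ih =>
    rw [M.run_succ, ← Set.inter_assoc]
    refine le_trans ?_ (mul_measureReal_le_of_le_condExp (M.F.le (n + r + 1))
      (c := Real.exp (-(k * N * Real.exp (-lam) ^ (r + 1))))
      (M.F.le _ _ (M.measurableSet_eq _ j))
      ((M.F.mono (by lia) _ hG).inter (M.measurableSet_run j n r)) ?_)
    · rw [Finset.sum_range_succ, neg_add_rev, Real.exp_add, mul_assoc]
      gcongr
    · filter_upwards [M.classify (n + r + 1) j] with ω hω hmem
      rw [hω]
      exact M.exp_neg_le_of_mem_run hmem.2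

lemma exp_neg_mul_measureReal_le_forever {j : Fin k} {n : ℕ} {G : Set Ω}
    (hG : MeasurableSet[M.F (n + 1)] G) (hGj : G ⊆ {ω | M.x n ω = j}) :
    Real.exp (-∑' s : ℕ, k * N * Real.exp (-lam) ^ (s + 1)) * μ.real G ≤
      μ.real (G ∩ M.forever j n) := by
  have := M.hprob
  have hsum : Summable fun s : ℕ => k * N * Real.exp (-lam) ^ (s + 1) :=
    (((summable_geometric_of_lt_one (Real.exp_pos _).le
      (Real.exp_lt_one_iff.2 (neg_lt_zero.2 M.hlam))).comp_injective
        (add_left_injective 1))).mul_left _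
  have hlim : Tendsto (fun r => μ.real (G ∩ M.run j n r)) atTop
      (𝓝 (μ.real (G ∩ M.forever j n))) := by
    rw [← M.iInter_run, Set.inter_iInter]
    refine (ENNReal.tendsto_toReal (measure_ne_top μ _)).comp
      (tendsto_measure_iInter_atTop (fun r => ?_) ?_ ⟨0, measure_ne_top μ _⟩)
    · exact ((M.F.le _ _ hG).inter (M.F.le _ _ (M.measurableSet_run j n r))).nullMeasurableSet
    · exact fun a b hab => Set.inter_subset_inter_right _ (M.antitone_run j n hab)
  refine ge_of_tendsto' hlim fun r => le_trans ?_ (M.exp_neg_mul_measureReal_le_run hG hGj r)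
  gcongr
  exact hsum.sum_le_tsum _ fun s _ => by positivity

lemma ae_mem_fixation : ∀ᵐ ω ∂μ, ω ∈ M.fixation := by
  have := M.hprob
  refine ae_mem_of_forall_le_condExp M.measurableSet_fixation
    (Real.exp_pos (-∑' s : ℕ, k * N * Real.exp (-lam) ^ (s + 1))) fun n => ?_
  have hle : (⨆ n, M.F n) ≤ mΩ := iSup_le fun n => M.F.le n
  have h : ∀ j, ∀ᵐ ω ∂μ, ω ∈ {ω | M.x n ω = j} → _ := fun j =>
    le_condExp_indicator_of_forall_subset (M.F.le (n + 1)) (hle _ M.measurableSet_fixation)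
      (M.measurableSet_eq n j) fun G hG hGj =>
        (M.exp_neg_mul_measureReal_le_forever hG hGj).trans <| measureReal_mono <|
          Set.inter_subset_inter_right _ <|
            Set.subset_iUnion_of_subset j <| Set.subset_iUnion (M.forever j) n
  filter_upwards [ae_all_iff.2 h] with ω hω
  exact hω (M.x n ω) rfl

lemma tendsto_weight_of_mem_forever {i j : Fin k} (hij : i ≠ j) {n : ℕ} {ω : Ω}
    (h : ω ∈ M.forever j n) : Tendsto (fun n => M.weight n i ω) atTop (𝓝 0) := by
  rw [← tendsto_add_atTop_iff_nat n]
  have hpow := (tendsto_pow_atTop_nhds_zero_of_lt_one (Real.exp_pos _).le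
    (Real.exp_lt_one_iff.2 (neg_lt_zero.2 M.hlam))).mul_const (M.weight n i ω)
  rw [zero_mul] at hpow
  refine hpow.congr fun r => ?_
  rw [add_comm r n, M.weight_add_of_ne hij fun s _ => h s]

end FiniteExemplarModel

/-- **Theorem 1 of the paper.** In the finite-capacity model, with
probability `1` there exist a time `M` and a category `j` such that `x_n = j` for
all `n ≥ M` (i.e. `P(⋃_n A_n) = 1`); in particular, with probability `1` all
categories but one become extinct: there is a category `j` such that
`W_i^n → 0` as `n → ∞` for every `i ≠ j`. -/
theorem finite_capacity_all_but_one_extinct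
    {Ω : Type*} [mΩ : MeasurableSpace Ω] {μ : Measure Ω} {k N : ℕ} {lam : ℝ}
    (M : FiniteExemplarModel Ω μ k N lam) :
    (∀ᵐ ω ∂μ, ∃ M₀ : ℕ, ∃ j : Fin k, ∀ n ≥ M₀, M.x n ω = j) ∧
    (∀ᵐ ω ∂μ, ∃ j : Fin k, ∀ i : Fin k, i ≠ j →
      Tendsto (fun n => ∑ m ∈ Finset.range N, M.w n i m ω) atTop (𝓝 0)) := by
  constructor
  · filter_upwards [M.ae_mem_fixation] with ω hω
    obtain ⟨j, n, h⟩ := by simpa only [FiniteExemplarModel.fixation, Set.mem_iUnion] using hω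
    refine ⟨n, j, fun m hm => ?_⟩
    obtain ⟨s, rfl⟩ := Nat.exists_eq_add_of_le hm
    exact h s
  · filter_upwards [M.ae_mem_fixation] with ω hω
    obtain ⟨j, n, h⟩ := by simpa only [FiniteExemplarModel.fixation, Set.mem_iUnion] using hω
    exact ⟨j, fun i hij => M.tendsto_weight_of_mem_forever hij h⟩
end

section
/- For each category j ∈ {1,…,k}, the process Z_j^n converges almost surely to a random variable Z_j^*, and Z_j^* takes only the values 0 and 1 with probability 1. -/
open MeasureTheory Filter Topology

/-- The simple exemplar weight model with unlimited capacity (`N = ∞`) from the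
paper "Effects of Limiting Memory Capacity on the Behaviour of Exemplar Dynamics".

There are `k ≥ 2` categories and the weights decay by `β = exp (-lam)` at each
step, `lam > 0`.  `W n j ω` is the total weight of category `j` at time `n`;
the initial weights are deterministic, nonnegative and not all zero.  At each
time a random category `x n` is chosen with conditional probability
`W_j^n / W_tot^n` given the natural filtration `F`, where `W_tot^n = ∑_j W_j^n`;
then `W_{x_n}^{n+1} = β W_{x_n}^n + 1` and `W_i^{n+1} = β W_i^n` for `i ≠ x_n`. -/
structure InfiniteExemplarModel (Ω : Type*) [mΩ : MeasurableSpace Ω] (μ : Measure Ω)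
    (k : ℕ) (lam : ℝ) where
  hk : 2 ≤ k
  hlam : 0 < lam
  hprob : IsProbabilityMeasure μ
  /-- the total weight of each category at each time -/
  W : ℕ → Fin k → Ω → ℝ
  /-- the category the sound at time `n` is classified as -/
  x : ℕ → Ω → Fin k
  /-- the natural filtration of the process -/
  F : Filtration ℕ mΩ
  nonneg : ∀ n j ω, 0 ≤ W n j ω
  init_det : ∀ j ω ω', W 0 j ω = W 0 j ω'
  init_nonzero : ∃ j ω, W 0 j ω ≠ 0
  W_meas : ∀ n j, StronglyMeasurable[F n] (W n j)
  x_meas : ∀ n, Measurable[F (n + 1)] (x n)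
  dyn_self : ∀ n ω, W (n + 1) (x n ω) ω = Real.exp (-lam) * W n (x n ω) ω + 1
  dyn_other : ∀ n ω i, i ≠ x n ω → W (n + 1) i ω = Real.exp (-lam) * W n i ω
  classify : ∀ n (j : Fin k),
    μ[Set.indicator {ω | x n ω = j} (fun _ => (1 : ℝ)) | F n]
      =ᵐ[μ] fun ω => W n j ω / (∑ i : Fin k, W n i ω)

namespace InfiniteExemplarModel

variable {Ω : Type*} [mΩ : MeasurableSpace Ω] {μ : Measure Ω} {k : ℕ} {lam : ℝ}

lemma weight_succ (M : InfiniteExemplarModel Ω μ k lam) (n : ℕ) (j : Fin k) (ω : Ω) :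
    M.W (n + 1) j ω =
      Real.exp (-lam) * M.W n j ω + Set.indicator {ω | M.x n ω = j} (fun _ => (1 : ℝ)) ω := by
  by_cases h : M.x n ω = j
  · subst h
    simp [M.dyn_self]
  · simp [M.dyn_other n ω j (Ne.symm h), h]

lemma total_succ (M : InfiniteExemplarModel Ω μ k lam) (n : ℕ) (ω : Ω) :
    ∑ i, M.W (n + 1) i ω = Real.exp (-lam) * ∑ i, M.W n i ω + 1 := by
  simp_rw [M.weight_succ, Finset.sum_add_distrib, ← Finset.mul_sum]
  simp [Set.indicator_apply]

lemma total_eq (M : InfiniteExemplarModel Ω μ k lam) (n : ℕ) (ω ω' : Ω) :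
    ∑ i, M.W n i ω = ∑ i, M.W n i ω' := by
  induction n with
  | zero => exact Finset.sum_congr rfl fun i _ => M.init_det i ω ω'
  | succ n ih => rw [M.total_succ, M.total_succ, ih]

lemma total_pos (M : InfiniteExemplarModel Ω μ k lam) (n : ℕ) (ω : Ω) :
    0 < ∑ i, M.W n i ω := by
  induction n with
  | zero =>
    obtain ⟨j, ω', h⟩ := M.init_nonzero
    refine Finset.sum_pos' (fun i _ => M.nonneg 0 i ω) ⟨j, Finset.mem_univ j, ?_⟩
    rw [M.init_det j ω ω']
    exact (M.nonneg 0 j ω').lt_of_ne' h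
  | succ n ih =>
    rw [M.total_succ]
    positivity

lemma exists_total_le (M : InfiniteExemplarModel Ω μ k lam) (ω : Ω) :
    ∃ C : ℝ, 0 < C ∧ ∀ n, ∑ i, M.W n i ω ≤ C := by
  have hβ : Real.exp (-lam) < 1 := Real.exp_lt_one_iff.2 (by linarith [M.hlam])
  have hβ' : 0 < 1 - Real.exp (-lam) := by linarith
  refine ⟨max (∑ i, M.W 0 i ω) (1 / (1 - Real.exp (-lam))),
    lt_max_of_lt_left (M.total_pos 0 ω), fun n => ?_⟩
  induction n with
  | zero => exact le_max_left _ _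
  | succ n ih =>
    rw [M.total_succ]
    have h1 := le_max_right (∑ i, M.W 0 i ω) (1 / (1 - Real.exp (-lam)))
    rw [div_le_iff₀ hβ'] at h1
    have h2 := mul_le_mul_of_nonneg_left ih (Real.exp_pos (-lam)).le
    linarith

/-- The fraction `Z_j^n` of the total weight carried by category `j` at time `n`. -/
noncomputable def fraction (M : InfiniteExemplarModel Ω μ k lam) (j : Fin k) (n : ℕ) (ω : Ω) : ℝ :=
  M.W n j ω / ∑ i, M.W n i ω

lemma fraction_nonneg (M : InfiniteExemplarModel Ω μ k lam) (j : Fin k) (n : ℕ) (ω : Ω) :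
    0 ≤ M.fraction j n ω :=
  div_nonneg (M.nonneg n j ω) (M.total_pos n ω).le

lemma fraction_le_one (M : InfiniteExemplarModel Ω μ k lam) (j : Fin k) (n : ℕ) (ω : Ω) :
    M.fraction j n ω ≤ 1 :=
  div_le_one_of_le₀
    (Finset.single_le_sum (fun i _ => M.nonneg n i ω) (Finset.mem_univ j)) (M.total_pos n ω).le

lemma norm_fraction_le_one (M : InfiniteExemplarModel Ω μ k lam) (j : Fin k) (n : ℕ) (ω : Ω) :
    ‖M.fraction j n ω‖ ≤ 1 := by
  rw [Real.norm_of_nonneg (M.fraction_nonneg j n ω)]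
  exact M.fraction_le_one j n ω

lemma fraction_succ_sub (M : InfiniteExemplarModel Ω μ k lam) (j : Fin k) (n : ℕ) (ω : Ω) :
    (M.fraction j (n + 1) ω - M.fraction j n ω) * ∑ i, M.W (n + 1) i ω =
      Set.indicator {ω | M.x n ω = j} (fun _ => (1 : ℝ)) ω - M.fraction j n ω := by
  have h := (M.total_pos n ω).ne'
  have h' := (M.total_pos (n + 1) ω).ne'
  have hW : M.fraction j n ω * ∑ i, M.W n i ω = M.W n j ω := div_mul_cancel₀ _ h
  have hW' : M.fraction j (n + 1) ω * ∑ i, M.W (n + 1) i ω = M.W (n + 1) j ω :=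
    div_mul_cancel₀ _ h'
  rw [sub_mul, hW', M.weight_succ, M.total_succ, ← hW]
  ring

lemma stronglyMeasurable_fraction (M : InfiniteExemplarModel Ω μ k lam) (j : Fin k) (n : ℕ) :
    StronglyMeasurable[M.F n] (M.fraction j n) := by
  obtain ⟨-, ω₀, -⟩ := M.init_nonzero
  have h : M.fraction j n = fun ω => M.W n j ω * (∑ i, M.W n i ω₀)⁻¹ := by
    funext ω
    rw [fraction, M.total_eq n ω ω₀, div_eq_mul_inv]
  rw [h]
  exact (M.W_meas n j).mul_const _

lemma integrable_fraction (M : InfiniteExemplarModel Ω μ k lam) (j : Fin k) (n : ℕ) :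
    Integrable (M.fraction j n) μ :=
  have := M.hprob
  .of_bound ((M.stronglyMeasurable_fraction j n).mono (M.F.le n)).aestronglyMeasurable 1
    (.of_forall (M.norm_fraction_le_one j n))

lemma martingale_fraction (M : InfiniteExemplarModel Ω μ k lam) (j : Fin k) :
    Martingale (M.fraction j) M.F μ := by
  have := M.hprob
  refine martingale_nat (M.stronglyMeasurable_fraction j) (M.integrable_fraction j) fun n => ?_
  obtain ⟨-, ω₀, -⟩ := M.init_nonzero
  set I : Ω → ℝ := Set.indicator {ω | M.x n ω = j} (fun _ => (1 : ℝ))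
  set c : ℝ := (∑ i, M.W (n + 1) i ω₀)⁻¹
  have hIint : Integrable I μ :=
    (integrable_const (1 : ℝ)).indicator
      (M.F.le (n + 1) _ (M.x_meas n (measurableSet_singleton j)))
  have hZ : M.fraction j (n + 1) = M.fraction j n + c • (I - M.fraction j n) := by
    funext ω
    have h := M.fraction_succ_sub j n ω
    have hpos := (M.total_pos (n + 1) ω₀).ne'
    rw [M.total_eq (n + 1) ω ω₀, ← eq_mul_inv_iff_mul_eq₀ hpos] at h
    simp only [Pi.add_apply, Pi.smul_apply, Pi.sub_apply, smul_eq_mul]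
    linarith
  have hself : μ[M.fraction j n | M.F n] = M.fraction j n :=
    condExp_of_stronglyMeasurable (M.F.le n) (M.stronglyMeasurable_fraction j n)
      (M.integrable_fraction j n)
  rw [hZ]
  have h1 := condExp_add (M.integrable_fraction j n)
    ((hIint.sub (M.integrable_fraction j n)).smul c) (M.F n)
  have h2 := condExp_smul (μ := μ) c (I - M.fraction j n) (M.F n)
  have h3 := condExp_sub hIint (M.integrable_fraction j n) (M.F n)
  filter_upwards [h1, h2, h3, M.classify n j] with ω h1 h2 h3 h4
  rw [h1, Pi.add_apply, h2, Pi.smul_apply, h3, Pi.sub_apply, hself, h4]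
  simp [fraction]

lemma ae_exists_tendsto_fraction (M : InfiniteExemplarModel Ω μ k lam) (j : Fin k) :
    ∀ᵐ ω ∂μ, ∃ L : ℝ, Tendsto (fun n => M.fraction j n ω) atTop (𝓝 L) := by
  have := M.hprob
  refine (M.martingale_fraction j).submartingale.exists_ae_tendsto_of_bdd (R := 1) fun n => ?_
  simpa using eLpNorm_le_of_ae_bound (p := 1) (μ := μ)
    (.of_forall (M.norm_fraction_le_one j n))

lemma eq_zero_or_one_of_tendsto_fraction (M : InfiniteExemplarModel Ω μ k lam) (j : Fin k)
    (ω : Ω) {L : ℝ} (hL : Tendsto (fun n => M.fraction j n ω) atTop (𝓝 L)) :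
    L = 0 ∨ L = 1 := by
  obtain ⟨C, hC, hle⟩ := M.exists_total_le ω
  have hdiff : Tendsto (fun n => |M.fraction j (n + 1) ω - M.fraction j n ω| * C) atTop (𝓝 0) := by
    simpa using (((tendsto_add_atTop_iff_nat 1).2 hL).sub hL).abs.mul_const C
  have hprod : Tendsto (fun n => M.fraction j n ω * (1 - M.fraction j n ω)) atTop (𝓝 0) := by
    refine squeeze_zero (fun n => ?_) (fun n => ?_) hdiff
    · exact mul_nonneg (M.fraction_nonneg j n ω) (sub_nonneg.2 (M.fraction_le_one j n ω))
    · refine le_trans ?_ (mul_le_mul_of_nonneg_left (hle (n + 1)) (abs_nonneg _))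
      rw [← abs_of_pos (M.total_pos (n + 1) ω), ← abs_mul, M.fraction_succ_sub]
      have h0 := M.fraction_nonneg j n ω
      have h1 := M.fraction_le_one j n ω
      by_cases h : M.x n ω = j
      · refine le_trans ?_ (le_abs_self _)
        simp only [Set.indicator_apply, Set.mem_ofPred_eq, h, if_true]
        nlinarith
      · refine le_trans ?_ (neg_le_abs _)
        simp only [Set.indicator_apply, Set.mem_ofPred_eq, h, if_false]
        nlinarith
  have h := tendsto_nhds_unique hprod (hL.mul (hL.const_sub 1))
  rcases mul_eq_zero.1 h.symm with h | h
  · exact .inl h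
  · exact .inr (by linarith)

end InfiniteExemplarModel

/-- **Theorem 3 of the paper.** For each category `j`, the weight
fraction `Z_j^n = W_j^n / W_tot^n` converges almost surely, and its limit takes
only the values `0` and `1` with probability `1`. -/
theorem weight_fraction_converges_to_zero_or_one
    {Ω : Type*} [mΩ : MeasurableSpace Ω] {μ : Measure Ω} {k : ℕ} {lam : ℝ}
    (M : InfiniteExemplarModel Ω μ k lam) (j : Fin k) :
    ∀ᵐ ω ∂μ, ∃ L : ℝ,
      Tendsto (fun n => M.W n j ω / (∑ i : Fin k, M.W n i ω)) atTop (𝓝 L) ∧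
      (L = 0 ∨ L = 1) := by
  filter_upwards [M.ae_exists_tendsto_fraction j] with ω ⟨L, hL⟩
  exact ⟨L, hL, M.eq_zero_or_one_of_tendsto_fraction j ω hL⟩
end

section
/- For every time step n there exists a category c ∈ {1,…,k} such that the conditional probability of classifying N consecutive sounds as c, starting at time n, satisfies P(x_{n+N−1} = c, …, x_{n+1} = c, x_n = c | F_n) ≥ k^{−N} almost surely. -/
open MeasureTheory Filter Topology

namespace FiniteExemplarModel

variable {Ω : Type*} [mΩ : MeasurableSpace Ω] {μ : Measure Ω} {k N : ℕ} {lam : ℝ}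

/-- The total weight of category `j` at time `n`. -/
def categoryWeight (M : FiniteExemplarModel Ω μ k N lam) (n : ℕ) (j : Fin k) (ω : Ω) : ℝ :=
  ∑ m ∈ Finset.range N, M.w n j m ω

/-- The event that category `c` has at least the average weight at time `n`. -/
def dominantSet (M : FiniteExemplarModel Ω μ k N lam) (n : ℕ) (c : Fin k) : Set Ω :=
  {ω | ∑ i, M.categoryWeight n i ω ≤ k * M.categoryWeight n c ω}

variable (M : FiniteExemplarModel Ω μ k N lam)

lemma categoryWeight_nonneg (n : ℕ) (j : Fin k) (ω : Ω) : 0 ≤ M.categoryWeight n j ω :=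
  Finset.sum_nonneg fun m _ => (M.range01 n j m ω).1

lemma sum_categoryWeight_pos (n : ℕ) (ω : Ω) : 0 < ∑ i, M.categoryWeight n i ω := by
  have key : ∀ j m, 0 < M.w n j m ω → 0 < ∑ i, M.categoryWeight n i ω := by
    intro j m h
    have hm : m < N := by
      by_contra! hle
      exact h.ne' (M.cap n j m ω hle)
    calc 0 < M.w n j m ω := h
      _ ≤ M.categoryWeight n j ω :=
        Finset.single_le_sum (f := fun m => M.w n j m ω)
          (fun m _ => (M.range01 n j m ω).1) (Finset.mem_range.2 hm)
      _ ≤ _ := Finset.single_le_sum (f := fun i => M.categoryWeight n i ω)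
          (fun i _ => M.categoryWeight_nonneg n i ω) (Finset.mem_univ j)
  cases n with
  | zero =>
    obtain ⟨j, m, ω', h⟩ := M.init_nonzero
    rw [M.init_det j m ω' ω] at h
    exact key j m ((M.range01 0 j m ω).1.lt_of_ne' h)
  | succ n =>
    refine key (M.x n ω) 0 ?_
    rw [M.dyn_self_first]
    exact one_pos

lemma categoryWeight_succ_of_ne {n : ℕ} {ω : Ω} {i : Fin k} (h : i ≠ M.x n ω) :
    M.categoryWeight (n + 1) i ω = Real.exp (-lam) * M.categoryWeight n i ω := by
  simp only [categoryWeight, Finset.mul_sum]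
  exact Finset.sum_congr rfl fun m _ => M.dyn_other n ω i m h

lemma exp_mul_categoryWeight_le_succ (n : ℕ) (ω : Ω) :
    Real.exp (-lam) * M.categoryWeight n (M.x n ω) ω
      ≤ M.categoryWeight (n + 1) (M.x n ω) ω := by
  obtain ⟨L, rfl⟩ : ∃ L, N = L + 1 := ⟨N - 1, by have := M.hN; omega⟩
  have hexp : Real.exp (-lam) ≤ 1 := Real.exp_le_one_iff.2 (by linarith [M.hlam])
  have hlast := M.range01 n (M.x n ω) L ω
  rw [categoryWeight, categoryWeight, Finset.sum_range_succ, Finset.sum_range_succ',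
    M.dyn_self_first, mul_add, Finset.mul_sum]
  refine add_le_add (Finset.sum_le_sum fun m hm => ?_)
    (mul_le_one₀ hexp hlast.1 hlast.2)
  rw [M.dyn_self n ω m (by simpa using hm)]

lemma mem_dominantSet_succ {n : ℕ} {c : Fin k} {ω : Ω} (h : ω ∈ M.dominantSet n c)
    (hx : M.x n ω = c) : ω ∈ M.dominantSet (n + 1) c := by
  subst hx
  have hself := M.exp_mul_categoryWeight_le_succ n ω
  have hk : (1 : ℝ) ≤ k := by exact_mod_cast one_le_two.trans M.hk
  have hsum := Finset.add_sum_erase Finset.univ (fun i => M.categoryWeight n i ω)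
    (Finset.mem_univ (M.x n ω))
  have hsum' := Finset.add_sum_erase Finset.univ (fun i => M.categoryWeight (n + 1) i ω)
    (Finset.mem_univ (M.x n ω))
  have hrest : ∑ i ∈ Finset.univ.erase (M.x n ω), M.categoryWeight (n + 1) i ω
      = Real.exp (-lam) * ∑ i ∈ Finset.univ.erase (M.x n ω), M.categoryWeight n i ω := by
    rw [Finset.mul_sum]
    exact Finset.sum_congr rfl fun i hi =>
      M.categoryWeight_succ_of_ne (Finset.ne_of_mem_erase hi)
  simp only [dominantSet, Set.mem_ofPred_eq] at h ⊢
  have hscaled := mul_le_mul_of_nonneg_left h (Real.exp_pos (-lam)).le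
  rw [← hsum, mul_add] at hscaled
  rw [← hsum', hrest]
  nlinarith [mul_nonneg (sub_nonneg.2 hk) (sub_nonneg.2 hself)]

lemma exists_mem_dominantSet (n : ℕ) (ω : Ω) : ∃ c, ω ∈ M.dominantSet n c := by
  have : Nonempty (Fin k) := ⟨⟨0, by have := M.hk; omega⟩⟩
  obtain ⟨c, hc⟩ := Finite.exists_max fun i => M.categoryWeight n i ω
  refine ⟨c, ?_⟩
  simpa [dominantSet] using Finset.sum_le_card_nsmul Finset.univ _ _ fun i _ => hc i

lemma inv_le_of_mem_dominantSet {n : ℕ} {c : Fin k} {ω : Ω} (h : ω ∈ M.dominantSet n c) :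
    (k : ℝ)⁻¹ ≤ M.categoryWeight n c ω / ∑ i, M.categoryWeight n i ω := by
  have hk : (0 : ℝ) < k := by exact_mod_cast two_pos.trans_le M.hk
  rw [le_div_iff₀ (M.sum_categoryWeight_pos n ω), inv_mul_le_iff₀ hk]
  exact h

lemma measurable_categoryWeight (n : ℕ) (j : Fin k) :
    Measurable[M.F n] (M.categoryWeight n j) :=
  Finset.measurable_fun_sum _ fun m _ => (M.w_meas n j m).measurable

lemma measurableSet_dominantSet (n : ℕ) (c : Fin k) :
    MeasurableSet[M.F n] (M.dominantSet n c) :=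
  measurableSet_le (Finset.measurable_fun_sum _ fun i _ => M.measurable_categoryWeight n i)
    ((M.measurable_categoryWeight n c).const_mul _)

lemma measurableSet_x_eq (n : ℕ) (c : Fin k) :
    MeasurableSet[M.F (n + 1)] {ω | M.x n ω = c} :=
  M.x_meas n (measurableSet_singleton c)

lemma measurableSet_consecutive (n r : ℕ) (c : Fin k) :
    MeasurableSet {ω | ∀ p < r, M.x (n + p) ω = c} := by
  have : {ω | ∀ p < r, M.x (n + p) ω = c} = ⋂ p, ⋂ _ : p < r, {ω | M.x (n + p) ω = c} := by
    ext; simp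
  rw [this]
  exact .iInter fun p => .iInter fun _ => M.F.le _ _ (M.measurableSet_x_eq (n + p) c)

lemma indicator_consecutive_succ (n r : ℕ) (c : Fin k) :
    Set.indicator {ω | ∀ p < r + 1, M.x (n + p) ω = c} (fun _ => (1 : ℝ))
      = Set.indicator {ω | M.x n ω = c}
        (Set.indicator {ω | ∀ p < r, M.x (n + 1 + p) ω = c} fun _ => 1) := by
  rw [Set.indicator_indicator]
  congr 1
  ext ω
  simp only [Set.mem_ofPred_eq, Set.mem_inter_iff]
  refine ⟨fun h => ⟨h 0 (by omega), fun p hp => ?_⟩, fun h p hp => ?_⟩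
  · rw [add_right_comm]
    exact h (p + 1) (by omega)
  · cases p with
    | zero => exact h.1
    | succ p =>
      rw [← add_assoc, add_right_comm]
      exact h.2 p (by omega)

/-- On the event that `c` has at least the average weight at time `n`, the conditional probability
that the next `r` sounds are all classified as `c` is at least `k⁻ʳ`. -/
lemma inv_pow_le_condExp_consecutive (c : Fin k) (r n : ℕ) :
    ∀ᵐ ω ∂μ, ω ∈ M.dominantSet n c →
      ((k : ℝ) ^ r)⁻¹ ≤
        (μ[Set.indicator {ω' | ∀ p < r, M.x (n + p) ω' = c} (fun _ => (1 : ℝ)) | M.F n]) ω := by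
  have := M.hprob
  induction r generalizing n with
  | zero =>
    refine .of_forall fun ω _ => ?_
    simp [condExp_const (M.F.le n)]
  | succ r ih =>
    set f : Ω → ℝ := Set.indicator {ω | ∀ p < r, M.x (n + 1 + p) ω = c} fun _ => 1 with hf
    set B := M.dominantSet n c with hB
    set X : Set Ω := {ω | M.x n ω = c} with hX
    set q : ℝ := ((k : ℝ) ^ r)⁻¹ with hq
    have hq0 : 0 ≤ q := by positivity
    have hBn : MeasurableSet[M.F n] B := M.measurableSet_dominantSet n c
    have hXn : MeasurableSet[M.F (n + 1)] X := M.measurableSet_x_eq n c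
    have hBX : MeasurableSet[M.F (n + 1)] (B ∩ X) :=
      (M.F.mono n.le_succ _ hBn).inter hXn
    have hfint : Integrable f μ :=
      (integrable_const 1).indicator (M.measurableSet_consecutive (n + 1) r c)
    have hXm : MeasurableSet X := M.F.le _ _ hXn
    have hone : Integrable (X.indicator fun _ => (1 : ℝ)) μ := (integrable_const 1).indicator hXm
    have hinner : q • B.indicator (X.indicator fun _ => (1 : ℝ))
        ≤ᵐ[μ] μ[B.indicator (X.indicator f) | M.F (n + 1)] := by
      rw [Set.indicator_indicator, Set.indicator_indicator]
      filter_upwards [condExp_indicator hfint hBX, ih (n + 1)] with ω h₁ h₂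
      rw [h₁]
      by_cases hω : ω ∈ B ∩ X
      · simpa [hω] using h₂ (M.mem_dominantSet_succ hω.1 hω.2)
      · simp [hω]
    have houter : μ[q • B.indicator (X.indicator fun _ => (1 : ℝ)) | M.F n]
        ≤ᵐ[μ] μ[μ[B.indicator (X.indicator f) | M.F (n + 1)] | M.F n] :=
      condExp_mono ((hone.indicator (M.F.le _ _ hBn)).smul q) integrable_condExp hinner
    rw [M.indicator_consecutive_succ]
    filter_upwards [houter, condExp_condExp_of_le (μ := μ) (f := B.indicator (X.indicator f))
        (M.F.mono n.le_succ) (M.F.le (n + 1)),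
      condExp_smul (μ := μ) q (B.indicator (X.indicator fun _ => (1 : ℝ))) (M.F n),
      condExp_indicator hone hBn, condExp_indicator (hfint.indicator hXm) hBn,
      M.classify n c] with ω h₁ h₂ h₃ h₄ h₅ h₆ hω
    rw [h₂, h₃, h₅, Pi.smul_apply, h₄, Set.indicator_of_mem hω, Set.indicator_of_mem hω, h₆,
      smul_eq_mul] at h₁
    rw [pow_succ, mul_inv]
    exact (mul_le_mul_of_nonneg_left (M.inv_le_of_mem_dominantSet hω) hq0).trans h₁

end FiniteExemplarModel

/-- **Equation (4) of the paper.** For every time step `n`, almost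
surely there exists a category `c` (chosen according to the realization, namely one
with `P(x_n = c | F_n) ≥ 1/k`) such that the conditional probability of classifying
`N` consecutive sounds as `c` starting at time `n` satisfies
`P(x_{n+N-1} = c, …, x_{n+1} = c, x_n = c | F_n) ≥ k^{-N}`. -/
theorem prob_N_consecutive_classifications_ge
    {Ω : Type*} [mΩ : MeasurableSpace Ω] {μ : Measure Ω} {k N : ℕ} {lam : ℝ}
    (M : FiniteExemplarModel Ω μ k N lam) (n : ℕ) :
    ∀ᵐ ω ∂μ, ∃ c : Fin k,
      ((k : ℝ) ^ N)⁻¹ ≤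
        (μ[Set.indicator {ω' | ∀ p < N, M.x (n + p) ω' = c}
            (fun _ => (1 : ℝ)) | M.F n]) ω := by
  filter_upwards [ae_all_iff.2 fun c => M.inv_pow_le_condExp_consecutive c N n] with ω h
  obtain ⟨c, hc⟩ := M.exists_mem_dominantSet n ω
  exact ⟨c, h c hc⟩
end
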